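/- arXiv:1907.08978 — 3 statements merged into one kernel-verified Lean document; each statement's English description precedes it below -/
import Mathlib

section
/- Aut(G) is action-closed with respect to the conjugation action of Hol(G) on the set of regular subgroups: for every regular subgroup 𝒢 of Hol(G) and every element x ∈ Hol(G), there exists an automorphism β ∈ Aut(G) such that x⁻¹·𝒢·x = (1,β)⁻¹·𝒢·(1,β), where (1,β) is the image of β in the canonical copy of Aut(G) inside Hol(G). -/
/-- The holomorph of a group `G`: the semidirect product `G ⋊ Aut(G)`. -/
abbrev Hol (G : Type*) [Group G] :=
  SemidirectProduct G (MulAut G) (MonoidHom.id (MulAut G))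

/-- The natural action of `Hol G` on `G`: `(h, α) • g = h * α g`. -/
instance holMulAction (G : Type*) [Group G] : MulAction (Hol G) G where
  smul x g := x.left * x.right g
  one_smul g := by
    show (1 : Hol G).left * (1 : Hol G).right g = g
    simp
  mul_smul x y g := by
    show (x * y).left * (x * y).right g = x.left * x.right (y.left * y.right g)
    simp [SemidirectProduct.mul_left, SemidirectProduct.mul_right, mul_assoc]

theorem hol_smul_def {G : Type*} [Group G] (x : Hol G) (g : G) :
    x • g = x.left * x.right g := rfl

/-- A subgroup of `Hol G` is regular if its natural action on `G` is transitive and free. -/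
def IsRegularSubgroup {G : Type*} [Group G] (𝒢 : Subgroup (Hol G)) : Prop :=
  (∀ g g' : G, ∃ x ∈ 𝒢, x • g = g') ∧
  (∀ x ∈ 𝒢, ∀ g : G, x • g = g → x = 1)

/-- The conjugate subgroup `x⁻¹ K x`. -/
def conjSubgroup {H : Type*} [Group H] (x : H) (K : Subgroup H) : Subgroup H :=
  K.map (MulAut.conj x⁻¹).toMonoidHom

theorem mem_conjSubgroup_iff {H : Type*} [Group H] {x h : H} {K : Subgroup H} :
    h ∈ conjSubgroup x K ↔ x * h * x⁻¹ ∈ K := by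
  simp only [conjSubgroup, Subgroup.mem_map]
  constructor
  · rintro ⟨k, hk, rfl⟩
    simpa [mul_assoc] using hk
  · intro hk
    exact ⟨_, hk, by simp [mul_assoc]⟩

theorem conjSubgroup_mul_of_mem {H : Type*} [Group H] {K : Subgroup H} {y : H} (hy : y ∈ K)
    (z : H) : conjSubgroup (y * z) K = conjSubgroup z K := by
  ext h
  have hconj : y * z * h * (y * z)⁻¹ = y * (z * h * z⁻¹) * y⁻¹ := by group
  rw [mem_conjSubgroup_iff, mem_conjSubgroup_iff, hconj,
    Subgroup.mul_mem_cancel_right _ (inv_mem hy), Subgroup.mul_mem_cancel_left _ hy]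

theorem exists_eq_mul_inr {G : Type*} [Group G] {x y : Hol G} (h : y • (1 : G) = x • (1 : G)) :
    ∃ β : MulAut G, x = y * SemidirectProduct.inr β := by
  have hleft : y.left = x.left := by simpa [hol_smul_def] using h
  exact ⟨y.right⁻¹ * x.right, SemidirectProduct.ext (by simp [hleft]) (by simp)⟩

/-- `Aut G` is action-closed for the conjugation action of `Hol G` on regular subgroups. -/
theorem aut_action_closed (G : Type*) [Group G] (𝒢 : Subgroup (Hol G))
    (hreg : IsRegularSubgroup 𝒢) (x : Hol G) :
    ∃ β : MulAut G,
      conjSubgroup x 𝒢 = conjSubgroup (SemidirectProduct.inr β : Hol G) 𝒢 := by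
  obtain ⟨y, hy, hyx⟩ := hreg.1 1 (x • (1 : G))
  obtain ⟨β, rfl⟩ := exists_eq_mul_inr hyx
  exact ⟨β, conjSubgroup_mul_of_mem hy _⟩
end

section
/- Let G be a finite p-group and 𝒮 a Sylow p-subgroup of Hol(G). Then for every regular subgroup 𝒢 of Hol(G) there exists an automorphism β ∈ Aut(G) such that the conjugate (1,β)⁻¹·𝒢·(1,β) is a regular subgroup of Hol(G) contained in 𝒮. In other words, the union of the Aut(G)-conjugacy classes of the regular subgroups contained in 𝒮 is the set of all regular subgroups of Hol(G). -/
/-- A regular subgroup of `Hol G` has the same cardinality as `G`. -/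
theorem IsRegularSubgroup.card_eq {G : Type*} [Group G] {K : Subgroup (Hol G)}
    (hK : IsRegularSubgroup K) : Nat.card K = Nat.card G := by
  refine Nat.card_congr (Equiv.ofBijective (fun x : K => (x : Hol G) • (1 : G)) ⟨?_, ?_⟩)
  · intro x y hxy
    have hxy' : (x : Hol G) • (1 : G) = (y : Hol G) • (1 : G) := hxy
    have h := hK.2 ((y : Hol G)⁻¹ * x) (K.mul_mem (K.inv_mem y.2) x.2) 1
      (by rw [mul_smul, hxy', inv_smul_smul])
    exact Subtype.ext (inv_mul_eq_one.mp h).symm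
  · intro g
    obtain ⟨x, hx, hxg⟩ := hK.1 1 g
    exact ⟨⟨x, hx⟩, hxg⟩

/-- Regularity is invariant under conjugation in `Hol G`. -/
theorem IsRegularSubgroup.conjSubgroup {G : Type*} [Group G] {K : Subgroup (Hol G)}
    (hK : IsRegularSubgroup K) (y : Hol G) : IsRegularSubgroup (conjSubgroup y K) := by
  constructor
  · intro g g'
    obtain ⟨x, hx, hxg⟩ := hK.1 (y • g) (y • g')
    refine ⟨_, ⟨x, hx, rfl⟩, ?_⟩
    simp only [MulEquiv.toMonoidHom_eq_coe, MonoidHom.coe_coe, MulAut.conj_apply, inv_inv]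
    rw [mul_smul, mul_smul, hxg, inv_smul_smul]
  · rintro _ ⟨x, hx, rfl⟩ g hg
    simp only [MulEquiv.toMonoidHom_eq_coe, MonoidHom.coe_coe, MulAut.conj_apply, inv_inv] at hg ⊢
    rw [mul_smul, mul_smul, inv_smul_eq_iff] at hg
    rw [hK.2 x hx _ hg]
    group

/-- Every regular subgroup of the holomorph of a finite `p`-group is `Aut G`-conjugate
to a regular subgroup contained in a given Sylow `p`-subgroup of the holomorph. -/
theorem regular_aut_conj_into_sylow (p : ℕ) [Fact p.Prime] (G : Type*) [Group G] [Finite G]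
    (hG : IsPGroup p G) (𝒮 : Sylow p (Hol G)) (𝒢 : Subgroup (Hol G))
    (hreg : IsRegularSubgroup 𝒢) :
    ∃ β : MulAut G,
      conjSubgroup (SemidirectProduct.inr β : Hol G) 𝒢 ≤ 𝒮 ∧
      IsRegularSubgroup (conjSubgroup (SemidirectProduct.inr β : Hol G) 𝒢) := by
  have hp : IsPGroup p 𝒢 := by
    obtain ⟨n, hn⟩ := IsPGroup.iff_card.mp hG
    exact IsPGroup.of_card (hreg.card_eq.trans hn)
  have : Finite (Hol G) := Finite.of_equiv _ SemidirectProduct.equivProd.symm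
  obtain ⟨T, hT⟩ := hp.exists_le_sylow
  obtain ⟨g, rfl⟩ := MulAction.exists_smul_eq (Hol G) T 𝒮
  have hN : ((SemidirectProduct.inl : G →* Hol G).range).Normal := by
    rw [SemidirectProduct.range_inl_eq_ker_rightHom]
    infer_instance
  have hle : (SemidirectProduct.inl : G →* Hol G).range ≤ T :=
    (hG.of_surjective _ (SemidirectProduct.inl : G →* Hol G).rangeRestrict_surjective
      ).le_sylow_of_normal T
  refine ⟨g⁻¹.right, ?_, hreg.conjSubgroup _⟩
  rintro _ ⟨t, ht, rfl⟩
  have hmem : (SemidirectProduct.inl g⁻¹.left : Hol G) ∈ T := hle ⟨_, rfl⟩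
  have hg : (SemidirectProduct.inr g⁻¹.right : Hol G)
      = (SemidirectProduct.inl g⁻¹.left)⁻¹ * g⁻¹ := by
    rw [eq_inv_mul_iff_mul_eq, SemidirectProduct.inl_left_mul_inr_right]
  have key := Subgroup.smul_mem_pointwise_smul _ (MulAut.conj g) (T : Subgroup (Hol G))
    (mul_mem (mul_mem hmem (hT ht)) (inv_mem hmem))
  open scoped Pointwise in
  change _ ∈ MulAut.conj g • (T : Subgroup (Hol G))
  convert key using 1
  rw [hg]
  simp only [MulEquiv.toMonoidHom_eq_coe, MonoidHom.coe_coe, MulAut.conj_apply, MulAut.smul_def]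
  group
end

section
/- Let 𝒢 be a regular subgroup of Hol(G), χ : G → 𝒢 the bijection sending g to the unique x ∈ 𝒢 with x • g = 1, and define g₁ ∘ g₂ := χ⁻¹(χ(g₂)·χ(g₁)), the product taken in Hol(G). Then the skew left brace compatibility identity holds: for all a, b, c ∈ G, a ∘ (b·c) = (a ∘ b)·a⁻¹·(a ∘ c), where the products and the inverse a⁻¹ are taken in the original group G. Hence (G, ·, ∘) is a skew left brace with additive group G. -/
/-- The operation `g₁ ∘ g₂ = χ⁻¹ (χ g₂ * χ g₁)` coming from a regular subgroup of
`Hol G` satisfies the skew left brace compatibility identity with the group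
operation of `G`. -/
theorem circ_skew_brace (G : Type*) [Group G] (𝒢 : Subgroup (Hol G))
    (hreg : IsRegularSubgroup 𝒢) (χ : G → Hol G)
    (hmem : ∀ g : G, χ g ∈ 𝒢) (hact : ∀ g : G, χ g • g = 1)
    (op : G → G → G) (hop : ∀ a b : G, χ (op a b) = χ b * χ a) :
    ∀ a b c : G, op a (b * c) = op a b * a⁻¹ * op a c := by
  have key : ∀ a b : G, (χ a).left * (χ a).right (op a b) = b := fun a b => by
    have h := hact (op a b)
    rw [hop, mul_smul, ← hact b] at h
    exact smul_left_cancel _ h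
  intro a b c
  have ha : (χ a).left * (χ a).right a = 1 := hact a
  apply (χ a).right.injective
  apply mul_left_cancel (a := (χ a).left)
  rw [key, map_mul, map_mul, map_inv, ← mul_assoc, ← mul_assoc, key,
    inv_eq_of_mul_eq_one_left ha, mul_assoc, key]
end
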